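/- arXiv:2206.10047 — 2 statements merged into one kernel-verified Lean document; each statement's English description precedes it below -/
import Mathlib

section
/- Let X be a subshift over a finite alphabet whose word complexity function p satisfies liminf_{q→∞} p(q)/q < ∞. Then there exists a constant δ_X > 0, depending only on X, such that every ergodic shift-invariant Borel probability measure μ on X is δ_X-partially rigid: there exists a sequence of positive integers t_n → ∞ such that liminf_{n→∞} μ(σ^{-t_n}A ∩ A) ≥ δ_X · μ(A) for every Borel set A ⊆ X. -/
open Filter MeasureTheory
open scoped ENNReal

/-- The left shift on biinfinite sequences. -/
def shift {A : Type*} (x : ℤ → A) : ℤ → A := fun n => x (n + 1)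

/-- The word `x_{[s, s+len)}` read off a biinfinite sequence. -/
def readWord {A : Type*} (x : ℤ → A) (s : ℤ) (len : ℕ) : List A :=
  (List.range len).map (fun i => x (s + (i : ℤ)))

/-- A finite word occurs (as a consecutive subword) in a biinfinite sequence. -/
def occursIn {A : Type*} (w : List A) (x : ℤ → A) : Prop :=
  ∃ k : ℤ, readWord x k w.length = w

/-- The word complexity function of a set `X` of biinfinite sequences. -/
noncomputable def scomplexity {A : Type*} (X : Set (ℤ → A)) (q : ℕ) : ℕ :=
  Set.ncard {w : List A | w.length = q ∧ ∃ x ∈ X, occursIn w x}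

open Set Topology in
/-- Ultrafilter limit of almost invariant sets in an ergodic system. -/
lemma exists_ulim_ge {Ω : Type*} [MeasurableSpace Ω] (μ : Measure Ω) [IsProbabilityMeasure μ]
    (f : Ω → Ω) (hf : Ergodic f μ) (E : ℕ → Set Ω)
    (δ : ℝ≥0∞) (hδ : ∀ n, δ ≤ μ (E n)) (hE : ∀ n, MeasurableSet (E n)) (U : Ultrafilter ℕ)
    (hinv : Tendsto (fun n => μ (f ⁻¹' E n \ E n)) (U : Filter ℕ) (𝓝 0)) (B : Set Ω)
    (hB : MeasurableSet B) :
    ∃ L, δ * μ B ≤ L ∧ Tendsto (fun n => μ (B ∩ E n)) (U : Filter ℕ) (𝓝 L) := by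
  have hlim : ∀ B : Set Ω, ∃ L, Tendsto (fun n => μ (B ∩ E n)) (U : Filter ℕ) (𝓝 L) := by
    intro B
    obtain ⟨L, -, hL⟩ := (isCompact_univ (X := ℝ≥0∞)).ultrafilter_le_nhds
      (U.map (fun n => μ (B ∩ E n))) (by simp)
    exact ⟨L, hL⟩
  choose m hm using hlim
  have hle : ∀ B, m B ≤ μ B := fun B =>
    le_of_tendsto' (hm B) (fun n => measure_mono inter_subset_left)
  have hmono : ∀ B C, B ⊆ C → m B ≤ m C := fun B C h =>
    le_of_tendsto_of_tendsto' (hm B) (hm C)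
      (fun n => measure_mono (inter_subset_inter_left _ h))
  have hadd : ∀ B C, MeasurableSet C → Disjoint B C → m (B ∪ C) = m B + m C := by
    intro B C hC h
    refine tendsto_nhds_unique (hm _) (((hm B).add (hm C)).congr ?_)
    intro n
    rw [union_inter_distrib_right, measure_union _ (hC.inter (hE n))]
    exact h.mono inter_subset_left inter_subset_left
  have hempty : m ∅ = 0 := le_antisymm ((hle ∅).trans (by simp)) bot_le
  have hfin : ∀ (g : ℕ → Set Ω), (∀ i, MeasurableSet (g i)) → Pairwise (Function.onFun Disjoint g) →
      ∀ N, m (⋃ i ∈ Finset.range N, g i) = ∑ i ∈ Finset.range N, m (g i) := by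
    intro g hg hd N
    induction N with
    | zero => simp [hempty]
    | succ N ih =>
      rw [Finset.sum_range_succ, ← ih, ← hadd _ _ (hg N)]
      · congr 1
        rw [Finset.range_add_one, Finset.set_biUnion_insert, union_comm]
      · rw [disjoint_iUnion₂_left]
        intro i hi
        exact hd (by simp at hi; omega)
  let ν : Measure Ω := Measure.ofMeasurable (fun s _ => m s) hempty (by
    intro g hg hd
    apply le_antisymm
    · have h1 : ∀ N, m (⋃ i, g i) ≤ ∑' i, m (g i) + μ (⋃ i, g (i + N)) := by
        intro N
        have : (⋃ i, g i) = (⋃ i ∈ Finset.range N, g i) ∪ ⋃ i, g (i + N) := by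
          ext x
          simp only [mem_iUnion, mem_union, Finset.mem_range]
          constructor
          · rintro ⟨i, hi⟩
            by_cases h : i < N
            · exact Or.inl ⟨i, h, hi⟩
            · exact Or.inr ⟨i - N, by rwa [Nat.sub_add_cancel (by omega)]⟩
          · rintro (⟨i, _, hi⟩ | ⟨i, hi⟩)
            · exact ⟨i, hi⟩
            · exact ⟨_, hi⟩
        rw [this, hadd _ _ (MeasurableSet.iUnion fun i => hg _), hfin g hg hd N]
        · gcongr
          · exact ENNReal.sum_le_tsum _
          · exact hle _
        · rw [disjoint_iUnion₂_left]
          intro i hi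
          rw [disjoint_iUnion_right]
          intro j
          exact hd (by simp at hi; omega)
      have h2 : Tendsto (fun N => ∑' i, m (g i) + μ (⋃ i, g (i + N))) atTop
          (𝓝 (∑' i, m (g i) + 0)) := by
        refine Tendsto.add tendsto_const_nhds ?_
        have h3 : ∀ N, μ (⋃ i, g (i + N)) = ∑' i, μ (g (i + N)) := fun N =>
          measure_iUnion (fun i j hij => hd (by omega)) (fun i => hg _)
        simp_rw [h3]
        apply ENNReal.tendsto_sum_nat_add (fun i => μ (g i))
        rw [← measure_iUnion hd hg]
        exact measure_ne_top _ _
      rw [add_zero] at h2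
      exact ge_of_tendsto' h2 h1
    · refine ENNReal.tsum_le_of_sum_range_le fun N => ?_
      rw [← hfin g hg hd N]
      exact hmono _ _ (iUnion₂_subset fun i _ => subset_iUnion g i))
  have hν : ∀ s, MeasurableSet s → ν s = m s := fun s hs => Measure.ofMeasurable_apply s hs
  have hνle : ν ≤ μ := Measure.le_iff.2 fun s hs => (hν s hs).trans_le (hle s)
  have hνfin : IsFiniteMeasure ν := isFiniteMeasure_of_le μ hνle
  have hνmap : ν ≤ ν.map f := by
    refine Measure.le_iff.2 fun s hs => ?_
    rw [Measure.map_apply hf.measurable hs, hν _ hs, hν _ (hf.measurable hs)]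
    have := (hm (f ⁻¹' s)).add hinv
    rw [add_zero] at this
    refine le_of_tendsto_of_tendsto' (hm s) this fun n => ?_
    rw [← hf.measure_preimage (hs.inter (hE n)).nullMeasurableSet]
    refine (measure_mono ?_).trans (measure_union_le _ _)
    intro x hx
    by_cases h : x ∈ E n
    · exact Or.inl ⟨hx.1, h⟩
    · exact Or.inr ⟨hx.2, h⟩
  have hpres : MeasurePreserving f ν ν := by
    refine ⟨hf.measurable, ?_⟩
    symm
    apply Measure.eq_of_le_of_measure_univ_eq hνmap
    rw [Measure.map_apply hf.measurable MeasurableSet.univ, preimage_univ]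
  obtain ⟨c, hc⟩ := hf.eq_smul_of_absolutelyContinuous hpres (Measure.absolutelyContinuous_of_le hνle)
  refine ⟨m B, ?_, hm B⟩
  have hδc : δ ≤ c := by
    have h1 : ν univ = c := by simp [hc]
    rw [← h1, hν _ MeasurableSet.univ]
    refine ge_of_tendsto' (hm univ) fun n => ?_
    simpa using hδ n
  rw [← hν B hB, hc]
  simp only [Measure.smul_apply, smul_eq_mul]
  gcongr

lemma shift_iterate {A : Type*} (n : ℕ) (x : ℤ → A) (k : ℤ) : shift^[n] x k = x (k + n) := by
  induction n generalizing x k with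
  | zero => simp
  | succ n ih =>
    rw [Function.iterate_succ_apply, ih]
    simp only [shift]
    congr 1
    push_cast
    ring

/-- The points that agree with their `t`-shift on the window `[-m, m]`. -/
def agreeSet (A : Type*) (m t : ℕ) : Set (ℤ → A) := {x | ∀ k : ℤ, |k| ≤ m → x k = x (k + t)}

lemma measurableSet_agreeSet {A : Type*} [Fintype A] [MeasurableSpace A]
    [MeasurableSingletonClass A] (m t : ℕ) : MeasurableSet (agreeSet A m t) := by
  have : agreeSet A m t = ⋂ k : ℤ, ⋂ _ : |k| ≤ m, {x | x k = x (k + t)} := by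
    ext x
    simp [agreeSet]
  rw [this]
  refine MeasurableSet.iInter fun k => MeasurableSet.iInter fun _ => ?_
  exact measurableSet_eq_fun (measurable_pi_apply _) (measurable_pi_apply _)

lemma agreeSet_anti {A : Type*} {m m' : ℕ} (h : m ≤ m') (t : ℕ) :
    agreeSet A m' t ⊆ agreeSet A m t := fun x hx k hk => hx k (hk.trans (by exact_mod_cast h))

lemma agreeSet_succ_subset {A : Type*} (m t : ℕ) :
    agreeSet A (m + 1) t ⊆ shift ⁻¹' agreeSet A m t := by
  intro x hx k hk
  simp only [shift]
  have := hx (k + 1) (by rw [abs_le] at *; push_cast; constructor <;> linarith)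
  rw [this]
  congr 1
  ring

lemma exists_almost_inv {A : Type*} [Fintype A] [MeasurableSpace A]
    [MeasurableSingletonClass A] (μ : Measure (ℤ → A)) [IsProbabilityMeasure μ]
    (hμ : Ergodic shift μ) (δ : ℝ≥0∞) (hδ : 0 < δ)
    (H : ∀ m T : ℕ, ∃ t, T ≤ t ∧ δ ≤ μ (agreeSet A m t)) (n : ℕ) :
    ∃ t k : ℕ, n ≤ t ∧ n ≤ k ∧ δ ≤ μ (agreeSet A k t) ∧
      μ (shift ⁻¹' agreeSet A k t \ agreeSet A k t) ≤ ((n : ℝ≥0∞) + 1)⁻¹ := by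
  obtain ⟨t, hnt, ht⟩ := H (n + (n + 1)) n
  have key : ∃ k, n ≤ k ∧ k < n + (n + 1) ∧
      μ (agreeSet A k t) < ((n : ℝ≥0∞) + 1)⁻¹ + μ (agreeSet A (k + 1) t) := by
    by_contra! hcon
    have h : ∀ j, j ≤ n + 1 →
        (j : ℝ≥0∞) * ((n : ℝ≥0∞) + 1)⁻¹ + μ (agreeSet A (n + j) t) ≤ μ (agreeSet A n t) := by
      intro j
      induction j with
      | zero => simp
      | succ j ih =>
        intro hj
        refine le_trans ?_ (ih (by omega))
        have := hcon (n + j) (by omega) (by omega)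
        push_cast
        rw [add_mul, one_mul, add_assoc]
        gcongr
        exact this
    have h1 := h (n + 1) le_rfl
    push_cast at h1
    rw [ENNReal.mul_inv_cancel (by simp) (by finiteness)] at h1
    have h2 : (1 : ℝ≥0∞) + δ ≤ 1 := (add_le_add_right ht 1).trans (h1.trans prob_le_one)
    have h3 : (1 : ℝ≥0∞) < 1 + δ := ENNReal.lt_add_right (by simp) hδ.ne'
    exact absurd h2 (not_le.2 h3)
  obtain ⟨k, hnk, hk, hlt⟩ := key
  refine ⟨t, k, hnt, hnk, ht.trans (measure_mono (agreeSet_anti hk.le t)), ?_⟩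
  calc μ (shift ⁻¹' agreeSet A k t \ agreeSet A k t)
      ≤ μ (shift ⁻¹' agreeSet A k t \ agreeSet A (k + 1) t) :=
        measure_mono (Set.sdiff_subset_sdiff_right (agreeSet_anti (Nat.le_succ k) t))
    _ = μ (agreeSet A k t) - μ (agreeSet A (k + 1) t) := by
        rw [measure_sdiff (agreeSet_succ_subset k t)
          (measurableSet_agreeSet _ _).nullMeasurableSet (measure_ne_top _ _),
          hμ.measure_preimage (measurableSet_agreeSet _ _).nullMeasurableSet]
    _ ≤ _ := tsub_le_iff_right.2 hlt.le

open Topology in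
lemma rigid_of_agree {A : Type*} [Fintype A] [MeasurableSpace A]
    [MeasurableSingletonClass A] (μ : Measure (ℤ → A)) [IsProbabilityMeasure μ]
    (hμ : Ergodic shift μ) (δ : ℝ≥0∞) (hδ : 0 < δ)
    (H : ∀ m T : ℕ, ∃ t, T ≤ t ∧ δ ≤ μ (agreeSet A m t)) :
    ∃ t : ℕ → ℕ, Tendsto t atTop atTop ∧
      ∀ B : Set (ℤ → A), MeasurableSet B →
        δ * μ B ≤ Filter.liminf (fun n => μ (shift^[t n] ⁻¹' B ∩ B)) atTop := by
  choose t k hnt hnk hδE hE using exists_almost_inv μ hμ δ hδ H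
  refine ⟨t, tendsto_atTop_mono hnt tendsto_id, fun B hB => ?_⟩
  by_contra! hlt
  obtain ⟨a, ha1, ha2⟩ := exists_between hlt
  have hfreq := frequently_lt_of_liminf_lt (by isBoundedDefault) ha1
  obtain ⟨U, hU⟩ : ∃ U : Ultrafilter ℕ,
      (U : Filter ℕ) ≤ atTop ⊓ 𝓟 {n | μ (shift^[t n] ⁻¹' B ∩ B) < a} := by
    have : NeBot (atTop ⊓ 𝓟 {n | μ (shift^[t n] ⁻¹' B ∩ B) < a}) :=
      frequently_mem_iff_neBot.1 hfreq
    exact ⟨Ultrafilter.of _, Ultrafilter.of_le _⟩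
  have hUtop : (U : Filter ℕ) ≤ atTop := hU.trans inf_le_left
  have hUa : ∀ᶠ n in (U : Filter ℕ), μ (shift^[t n] ⁻¹' B ∩ B) < a :=
    (hU.trans inf_le_right) (mem_principal_self _)
  have hinv : Tendsto (fun n => μ (shift ⁻¹' agreeSet A (k n) (t n) \ agreeSet A (k n) (t n)))
      (U : Filter ℕ) (𝓝 0) := by
    refine Tendsto.mono_left ?_ hUtop
    refine tendsto_of_tendsto_of_tendsto_of_le_of_le tendsto_const_nhds ?_ (fun n => bot_le) hE
    have := (tendsto_add_atTop_iff_nat 1).2 ENNReal.tendsto_inv_nat_nhds_zero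
    simpa using this
  obtain ⟨L, hL, hlim⟩ := exists_ulim_ge μ shift hμ (fun n => agreeSet A (k n) (t n)) δ hδE
    (fun n => measurableSet_agreeSet _ _) U hinv B hB
  have hLa : L ≤ a := by
    refine ENNReal.le_of_forall_pos_le_add fun ε hε _ => ?_
    have hdense : μ.MeasureDense (measurableCylinders fun _ : ℤ => A) :=
      Measure.MeasureDense.of_generateFrom_isSetAlgebra_finite μ isSetAlgebra_measurableCylinders
        generateFrom_measurableCylinders.symm
    obtain ⟨C, hC, hCB⟩ := hdense.approx B hB (measure_ne_top _ _) (ε / 2) (by positivity)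
    have hCm := hdense.measurable C hC
    obtain ⟨s, S, -, rfl⟩ := (mem_measurableCylinders C).1 hC
    obtain ⟨N, hN⟩ : ∃ N : ℕ, ∀ j ∈ s, |j| ≤ N := by
      refine ⟨s.sup Int.natAbs, fun j hj => ?_⟩
      have := Finset.le_sup (f := Int.natAbs) hj
      rw [Int.abs_eq_natAbs]
      exact_mod_cast this
    have hNU : ∀ᶠ n in (U : Filter ℕ), N ≤ n := hUtop (eventually_ge_atTop N)
    refine le_of_tendsto hlim ?_
    filter_upwards [hNU, hUa] with n hn hna
    have hsub : B ∩ agreeSet A (k n) (t n) ⊆ (shift^[t n] ⁻¹' B ∩ B) ∪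
        (symmDiff B (cylinder s S) ∪ shift^[t n] ⁻¹' (symmDiff B (cylinder s S))) := by
      rintro x ⟨hxB, hxE⟩
      by_cases hxC : x ∈ cylinder s S
      · have : shift^[t n] x ∈ cylinder s S := by
          rw [mem_cylinder] at hxC ⊢
          convert hxC using 1
          ext j
          simp only [Finset.restrict]
          rw [shift_iterate]
          refine (hxE j ((hN j j.2).trans ?_)).symm
          exact_mod_cast hn.trans (hnk n)
        by_cases hB' : shift^[t n] x ∈ B
        · exact Or.inl ⟨hB', hxB⟩
        · exact Or.inr (Or.inr (Or.inr ⟨this, hB'⟩))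
      · exact Or.inr (Or.inl (Or.inl ⟨hxB, hxC⟩))
    calc μ (B ∩ agreeSet A (k n) (t n)) ≤ _ := measure_mono hsub
      _ ≤ _ := measure_union_le _ _
      _ ≤ a + (ENNReal.ofReal (ε / 2) + ENNReal.ofReal (ε / 2)) := by
        refine add_le_add hna.le ((measure_union_le _ _).trans (add_le_add hCB.le ?_))
        rw [(hμ.toMeasurePreserving.iterate (t n)).measure_preimage
          (hB.symmDiff hCm).nullMeasurableSet]
        exact hCB.le
      _ = a + ε := by
        rw [← ENNReal.ofReal_add (by positivity) (by positivity)]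
        simp
  exact absurd (hL.trans hLa) (not_le.2 ha2)

/-- The word of length `r` of `x` at position `n`, as a function on `Fin r`. -/
def wd {A : Type*} (r : ℕ) (x : ℤ → A) (n : ℕ) : Fin r → A := fun i => x ((n : ℤ) + (i : ℕ))

/-- The words of length `r` of `X`. -/
def lang {A : Type*} (X : Set (ℤ → A)) (r : ℕ) : Set (Fin r → A) := {w | ∃ x ∈ X, wd r x 0 = w}

/-- The right special words of length `r` of `X`. -/
def spec {A : Type*} (X : Set (ℤ → A)) (r : ℕ) : Set (Fin r → A) :=
  {w | ∃ x ∈ X, ∃ y ∈ X, wd r x 0 = w ∧ wd r y 0 = w ∧ x r ≠ y r}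

/-- Drop the first letter of a word and append a letter. -/
def succWord {A : Type*} {r : ℕ} (w : Fin r → A) (a : A) : Fin r → A :=
  fun i => if h : (i : ℕ) + 1 < r then w ⟨(i : ℕ) + 1, h⟩ else a

lemma wd_succ {A : Type*} (r : ℕ) (x : ℤ → A) (n : ℕ) :
    wd r x (n + 1) = succWord (wd r x n) (x ((n : ℤ) + r)) := by
  ext i
  simp only [wd, succWord]
  split_ifs with h
  · congr 1
    push_cast
    ring
  · congr 1
    have : r = (i : ℕ) + 1 := by have := i.2; omega
    push_cast
    omega

lemma iterate_mem {A : Type*} {X : Set (ℤ → A)} (hinv : shift ⁻¹' X = X) (n : ℕ) {x : ℤ → A}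
    (hx : x ∈ X) : shift^[n] x ∈ X := by
  induction n generalizing x with
  | zero => exact hx
  | succ n ih =>
    rw [Function.iterate_succ_apply]
    apply ih
    rw [← hinv] at hx
    exact hx

lemma wd_iterate {A : Type*} (r : ℕ) (x : ℤ → A) (n : ℕ) : wd r (shift^[n] x) 0 = wd r x n := by
  ext i
  simp only [wd, shift_iterate]
  congr 1
  push_cast
  ring

lemma wd_mem_lang {A : Type*} {X : Set (ℤ → A)} (hinv : shift ⁻¹' X = X) (r n : ℕ) {x : ℤ → A}
    (hx : x ∈ X) : wd r x n ∈ lang X r := ⟨_, iterate_mem hinv n hx, wd_iterate r x n⟩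

lemma exists_ext {A : Type*} {X : Set (ℤ → A)} (hne : X.Nonempty) (hinv : shift ⁻¹' X = X)
    (r : ℕ) : ∃ e : (Fin r → A) → A, ∀ x ∈ X, ∀ n : ℕ, wd r x n ∉ spec X r →
      x ((n : ℤ) + r) = e (wd r x n) := by
  classical
  obtain ⟨x0, -⟩ := hne
  refine ⟨fun w => if h : ∃ x ∈ X, wd r x 0 = w then h.choose r else x0 0, ?_⟩
  intro x hx n hn
  have h : ∃ y ∈ X, wd r y 0 = wd r x n := wd_mem_lang hinv r n hx
  simp only [dif_pos h]
  by_contra hcon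
  apply hn
  refine ⟨_, iterate_mem hinv n hx, _, h.choose_spec.1, wd_iterate r x n, h.choose_spec.2, ?_⟩
  rw [shift_iterate, add_comm]
  exact hcon

lemma exists_spec_window {A : Type*} [Fintype A] {X : Set (ℤ → A)} (hne : X.Nonempty)
    (hinv : shift ⁻¹' X = X)
    (r W : ℕ) (hr : 1 ≤ r) (hW : (lang X r).ncard < W) (x : ℤ → A) (hx : x ∈ X)
    (hper : ¬ ∃ a P : ℕ, 1 ≤ P ∧ ∀ k : ℕ, x ((a : ℤ) + k) = x ((a : ℤ) + k + P)) (i : ℕ) :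
    ∃ n, i ≤ n ∧ n < i + W ∧ wd r x n ∈ spec X r := by
  classical
  by_contra! hcon
  obtain ⟨e, he⟩ := exists_ext hne hinv r
  have hfin : (lang X r).Finite := Set.toFinite _
  obtain ⟨a, ha, b, hb, hab, hw⟩ : ∃ a ∈ Finset.Ico i (i + W), ∃ b ∈ Finset.Ico i (i + W),
      a ≠ b ∧ wd r x a = wd r x b := by
    apply Finset.exists_ne_map_eq_of_card_lt_of_maps_to (t := hfin.toFinset)
    · rw [← Set.ncard_eq_toFinset_card]
      simpa using hW
    · intro n _
      simpa using wd_mem_lang hinv r n hx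
  wlog hlt : a < b generalizing a b
  · exact this b hb a ha hab.symm hw.symm (by omega)
  rw [Finset.mem_Ico] at ha hb
  have hns : ∀ n, a ≤ n → ∃ c, a ≤ c ∧ c < b ∧ wd r x n = wd r x c := by
    intro n hn
    induction n, hn using Nat.le_induction with
    | base => exact ⟨a, le_rfl, hlt, rfl⟩
    | succ n hn ih =>
      obtain ⟨c, hac, hcb, hc⟩ := ih
      have h1 : wd r x c ∉ spec X r := hcon c (by omega) (by omega)
      have h2 : wd r x (n + 1) = wd r x (c + 1) := by
        rw [wd_succ, wd_succ, he x hx n (hc ▸ h1), he x hx c h1, hc]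
      by_cases h : c + 1 = b
      · exact ⟨a, le_rfl, hlt, by rw [h2, h, hw]⟩
      · exact ⟨c + 1, by omega, by omega, h2⟩
  have hnspec : ∀ n, a ≤ n → wd r x n ∉ spec X r := by
    intro n hn
    obtain ⟨c, hac, hcb, hc⟩ := hns n hn
    rw [hc]
    exact hcon c (by omega) (by omega)
  have heq : ∀ k, wd r x (a + k) = wd r x (b + k) := by
    intro k
    induction k with
    | zero => exact hw
    | succ k ih =>
      rw [← add_assoc, ← add_assoc, wd_succ, wd_succ, he x hx _ (hnspec _ (by omega)),
        he x hx _ (hnspec _ (by omega)), ih]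
  refine hper ⟨a, b - a, by omega, fun k => ?_⟩
  have := congrFun (heq k) ⟨0, hr⟩
  simp only [wd] at this
  push_cast [Nat.cast_sub hlt.le] at this ⊢
  rw [add_zero, add_zero] at this
  rw [this]
  congr 1
  ring

lemma comb {A : Type*} [Fintype A] {X : Set (ℤ → A)} (hne : X.Nonempty)
    (hinv : shift ⁻¹' X = X) (r W D : ℕ) (hr : 1 ≤ r) (hW : (lang X r).ncard < W)
    (hD : (spec X r).ncard ≤ D) :
    ∃ Ts : Finset ℕ, Ts.card ≤ D * Fintype.card A ^ D ∧ (∀ t ∈ Ts, 1 ≤ t) ∧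
      ∀ x ∈ X, (∃ a P : ℕ, 1 ≤ P ∧ ∀ k : ℕ, x ((a : ℤ) + k) = x ((a : ℤ) + k + P)) ∨
        ∃ s ≤ (D + 1) * W, ∃ t ∈ Ts, ∀ k : ℕ, k < r → x ((s : ℤ) + k) = x ((s : ℤ) + k + t) := by
  classical
  obtain ⟨e, he⟩ := exists_ext hne hinv r
  let nxt : (spec X r → A) → (Fin r → A) → (Fin r → A) := fun g w =>
    succWord w (if h : w ∈ spec X r then g ⟨w, h⟩ else e w)
  let Ts0 : Finset ℕ := (Finset.univ : Finset (spec X r × (spec X r → A))).image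
    (fun p => Function.minimalPeriod (nxt p.2) p.1.1)
  refine ⟨Ts0.filter (1 ≤ ·), ?_, fun t ht => (Finset.mem_filter.1 ht).2, ?_⟩
  · refine (Finset.card_filter_le _ _).trans (Finset.card_image_le.trans ?_)
    have hc : Fintype.card (spec X r) ≤ D := by
      rwa [← Nat.card_eq_fintype_card, Nat.card_coe_set_eq]
    rw [Finset.card_univ, Fintype.card_prod, Fintype.card_fun]
    have hA : 1 ≤ Fintype.card A := Fintype.card_pos_iff.2 ⟨hne.some 0⟩
    exact Nat.mul_le_mul hc (Nat.pow_le_pow_right hA hc)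
  · intro x hx
    by_cases hper : ∃ a P : ℕ, 1 ≤ P ∧ ∀ k : ℕ, x ((a : ℤ) + k) = x ((a : ℤ) + k + P)
    · exact Or.inl hper
    right
    choose n hn1 hn2 hn3 using exists_spec_window hne hinv r W hr hW x hx hper
    have hex : ∃ t, 1 ≤ t ∧ ∃ a, a + t ≤ (D + 1) * W ∧ wd r x a = wd r x (a + t) ∧
        wd r x a ∈ spec X r := by
      have hfin : (spec X r).Finite := Set.toFinite _
      obtain ⟨i, hi, j, hj, hij, hw⟩ : ∃ i ∈ Finset.range (D + 1), ∃ j ∈ Finset.range (D + 1),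
          i ≠ j ∧ wd r x (n (i * W)) = wd r x (n (j * W)) := by
        apply Finset.exists_ne_map_eq_of_card_lt_of_maps_to (t := hfin.toFinset)
        · rw [← Set.ncard_eq_toFinset_card]
          simp
          omega
        · intro i _
          simpa using hn3 (i * W)
      wlog hlt : i < j generalizing i j
      · exact this j hj i hi hij.symm hw.symm (by omega)
      have h1 : (i + 1) * W ≤ j * W := Nat.mul_le_mul_right _ hlt
      have h2 : (j + 1) * W ≤ (D + 1) * W := Nat.mul_le_mul_right _ (by simp at hj; omega)
      have h3 := hn2 (i * W)
      have h4 := hn1 (j * W)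
      have h5 := hn2 (j * W)
      rw [add_mul] at h1 h2
      refine ⟨n (j * W) - n (i * W), by omega, n (i * W), by omega, ?_, hn3 _⟩
      rw [hw]
      congr 1
      omega
    obtain ⟨⟨ht1, a, hat, hwa, hsa⟩, hmin⟩ := And.intro (Nat.find_spec hex)
      (fun t => Nat.find_min (H := hex) (m := t))
    set t := Nat.find hex with htdef
    refine ⟨a, by omega, t, ?_, ?_⟩
    · rw [Finset.mem_filter]
      refine ⟨?_, ht1⟩
      let g : spec X r → A := fun w =>
        if h : ∃ c, a ≤ c ∧ c < a + t ∧ wd r x c = w.1 then x ((h.choose : ℤ) + r) else x 0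
      have hg : ∀ c, a ≤ c → c < a + t → nxt g (wd r x c) = wd r x (c + 1) := by
        intro c hac hct
        rw [wd_succ]
        simp only [nxt]
        congr 1
        split_ifs with h
        · have h' : ∃ c', a ≤ c' ∧ c' < a + t ∧ wd r x c' = wd r x c := ⟨c, hac, hct, rfl⟩
          simp only [g, dif_pos h']
          obtain ⟨hs1, hs2, hs3⟩ := h'.choose_spec
          set c' := h'.choose
          suffices c' = c by rw [this]
          by_contra hne'
          rcases lt_or_gt_of_ne hne' with hlt | hlt
          · refine hmin (c - c') (by omega) ⟨by omega, c', by omega, ?_, hs3 ▸ h⟩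
            rw [hs3]; congr 1; omega
          · refine hmin (c' - c) (by omega) ⟨by omega, c, by omega, ?_, h⟩
            rw [← hs3]; congr 1; omega
        · exact (he x hx c h).symm
      have hit : ∀ k ≤ t, (nxt g)^[k] (wd r x a) = wd r x (a + k) := by
        intro k
        induction k with
        | zero => simp
        | succ k ih =>
          intro hk
          rw [Function.iterate_succ_apply', ih (by omega), hg _ (by omega) (by omega)]
          rfl
      refine Finset.mem_image.2 ⟨(⟨wd r x a, hsa⟩, g), Finset.mem_univ _, ?_⟩
      simp only
      have hp : Function.IsPeriodicPt (nxt g) t (wd r x a) := by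
        have := hit t le_rfl
        rw [← hwa] at this
        exact this
      have hle := hp.minimalPeriod_le ht1
      have hpos := hp.minimalPeriod_pos ht1
      by_contra hne'
      have hlt : Function.minimalPeriod (nxt g) (wd r x a) < t := lt_of_le_of_ne hle hne'
      refine hmin _ hlt ⟨hpos, a, by omega, ?_, hsa⟩
      rw [← hit _ hle]
      exact (Function.isPeriodicPt_minimalPeriod (nxt g) (wd r x a)).symm
    · intro k hk
      have := congrFun hwa ⟨k, hk⟩
      simp only [wd] at this
      rw [this]
      congr 1
      push_cast
      ring

lemma ncard_lang_le {A : Type*} [Fintype A] (X : Set (ℤ → A)) (q : ℕ) :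
    (lang X q).ncard ≤ scomplexity X q := by
  refine Set.ncard_le_ncard_of_injOn (fun w => List.ofFn w) ?_ ?_ ?_
  · rintro w ⟨x, hx, rfl⟩
    refine ⟨by simp, x, hx, 0, ?_⟩
    apply List.ext_getElem
    · simp [readWord]
    · intro i h1 h2
      simp only [readWord, List.getElem_map, List.getElem_ofFn, wd, List.pure_def,
        List.bind_eq_flatMap, ← List.map_eq_flatMap, List.getElem_range]
      rfl
  · intro w _ w' _ h
    exact List.ofFn_injective h
  · exact (List.finite_length_eq A q).subset fun w hw => hw.1

lemma ncard_lang_succ {A : Type*} [Fintype A] (X : Set (ℤ → A)) (hne : X.Nonempty) (r : ℕ) :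
    (lang X r).ncard + (spec X r).ncard ≤ (lang X (r + 1)).ncard := by
  classical
  have hx : ∀ w : Fin r → A, ∃ x : ℤ → A, w ∈ lang X r → x ∈ X ∧ wd r x 0 = w := by
    intro w
    by_cases h : w ∈ lang X r
    · obtain ⟨x, h1, h2⟩ := h
      exact ⟨x, fun _ => ⟨h1, h2⟩⟩
    · exact ⟨hne.some, fun h' => absurd h' h⟩
  choose x hx using hx
  have hy : ∀ w : Fin r → A, ∃ y : ℤ → A, w ∈ spec X r → y ∈ X ∧ wd r y 0 = w ∧ y r ≠ x w r := by
    intro w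
    by_cases h : w ∈ spec X r
    · obtain ⟨y, hy, z, hz, hyw, hzw, hyz⟩ := h
      by_cases hyx : y r = x w r
      · exact ⟨z, fun _ => ⟨hz, hzw, fun h => hyz (hyx.trans h.symm)⟩⟩
      · exact ⟨y, fun _ => ⟨hy, hyw, hyx⟩⟩
    · exact ⟨hne.some, fun h' => absurd h' h⟩
  choose y hy using hy
  have hres : ∀ u v : ℤ → A, wd (r + 1) u 0 = wd (r + 1) v 0 → wd r u 0 = wd r v 0 ∧ u r = v r := by
    intro u v h
    constructor
    · ext i
      exact congrFun h i.castSucc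
    · simpa [wd] using congrFun h (Fin.last r)
  have hsub : (fun w => wd (r + 1) (x w) 0) '' lang X r ∪ (fun w => wd (r + 1) (y w) 0) '' spec X r
      ⊆ lang X (r + 1) := by
    rintro _ (⟨w, hw, rfl⟩ | ⟨w, hw, rfl⟩)
    · exact ⟨_, (hx w hw).1, rfl⟩
    · exact ⟨_, (hy w hw).1, rfl⟩
  have hdisj : Disjoint ((fun w => wd (r + 1) (x w) 0) '' lang X r)
      ((fun w => wd (r + 1) (y w) 0) '' spec X r) := by
    rw [Set.disjoint_left]
    rintro _ ⟨w, hw, rfl⟩ ⟨w', hw', h⟩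
    obtain ⟨h1, h2⟩ := hres _ _ h
    rw [(hx w hw).2, (hy w' hw').2.1] at h1
    subst h1
    exact (hy w' hw').2.2 h2
  refine le_trans (le_of_eq ?_) (Set.ncard_le_ncard hsub (Set.toFinite _))
  rw [Set.ncard_union_eq hdisj (Set.toFinite _) (Set.toFinite _), Set.InjOn.ncard_image,
    Set.InjOn.ncard_image]
  · intro w hw w' hw' h
    have := (hres _ _ h).1
    rwa [(hy w hw).2.1, (hy w' hw').2.1] at this
  · intro w hw w' hw' h
    have := (hres _ _ h).1
    rwa [(hx w hw).2, (hx w' hw').2] at this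

lemma exists_good_length {A : Type*} [Fintype A] (X : Set (ℤ → A)) (hne : X.Nonempty)
    (C : ℕ) (hC : ∃ᶠ q : ℕ in atTop, scomplexity X q ≤ C * q) (N : ℕ) :
    ∃ r, N ≤ r ∧ (lang X r).ncard ≤ 3 * C * r ∧ (spec X r).ncard ≤ 2 * C := by
  obtain ⟨q, hq, hqC⟩ := frequently_atTop.1 hC (2 * N + 2)
  have hqC' := (ncard_lang_le X q).trans hqC
  have hmono : Monotone fun r => (lang X r).ncard :=
    monotone_nat_of_le_succ fun r => (Nat.le_add_right _ _).trans (ncard_lang_succ X hne r)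
  have hex : ∃ r, q / 2 ≤ r ∧ r < q ∧ (spec X r).ncard ≤ 2 * C := by
    by_contra! hcon
    have h : ∀ j, q / 2 + j ≤ q → j * (2 * C + 1) ≤ (lang X (q / 2 + j)).ncard := by
      intro j
      induction j with
      | zero => simp
      | succ j ih =>
        intro hj
        have h1 := ih (by omega)
        have h2 := hcon (q / 2 + j) (by omega) (by omega)
        have h3 := ncard_lang_succ X hne (q / 2 + j)
        rw [add_mul, ← add_assoc]
        omega
    have h1 := h (q - q / 2) (by omega)
    rw [show q / 2 + (q - q / 2) = q by omega] at h1
    have h2 : q ≤ 2 * (q - q / 2) := by omega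
    have h3 : C * q ≤ C * (2 * (q - q / 2)) := Nat.mul_le_mul_left _ h2
    have h4 : 0 < q - q / 2 := by omega
    nlinarith
  obtain ⟨r, hr1, hr2, hr3⟩ := hex
  refine ⟨r, by omega, ?_, hr3⟩
  calc (lang X r).ncard ≤ (lang X q).ncard := hmono hr2.le
    _ ≤ C * q := hqC'
    _ ≤ C * (3 * r) := Nat.mul_le_mul_left _ (by omega)
    _ = 3 * C * r := by ring

lemma exists_linear_bound {A : Type*} (X : Set (ℤ → A))
    (hp : Filter.liminf (fun q => (scomplexity X q : ℝ≥0∞) / (q : ℝ≥0∞)) atTop < ⊤) :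
    ∃ C : ℕ, 1 ≤ C ∧ ∃ᶠ q : ℕ in atTop, scomplexity X q ≤ C * q := by
  obtain ⟨c, hc1, hc2⟩ := exists_between hp
  obtain ⟨C, hC⟩ := ENNReal.exists_nat_gt hc2.ne
  refine ⟨C + 1, by omega, ?_⟩
  have hfreq := frequently_lt_of_liminf_lt (by isBoundedDefault) hc1
  refine (hfreq.and_eventually (eventually_ge_atTop 1)).mono ?_
  rintro q ⟨hq, hq1⟩
  have h1 : (scomplexity X q : ℝ≥0∞) ≤ (C : ℝ≥0∞) * q := by
    have := (hq.trans hC).le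
    rwa [ENNReal.div_le_iff (by simp; omega) (by simp)] at this
  have h2 : scomplexity X q ≤ C * q := by exact_mod_cast h1
  exact h2.trans (Nat.mul_le_mul_right _ (by omega))

lemma period_mul {A : Type*} (x : ℤ → A) (s t r : ℕ)
    (h : ∀ k : ℕ, k < r → x ((s : ℤ) + k) = x ((s : ℤ) + k + t)) (T k : ℕ)
    (hk : k + t * T < r + t) : x ((s : ℤ) + k) = x ((s : ℤ) + k + (t * T : ℕ)) := by
  induction T with
  | zero => simp
  | succ T ih =>
    rw [mul_add, mul_one] at hk
    rw [ih (by omega)]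
    have := h (k + t * T) (by omega)
    rw [show (s : ℤ) + k + (t * T : ℕ) = (s : ℤ) + (k + t * T : ℕ) by push_cast; ring, this]
    congr 1
    push_cast
    ring

/-- The points whose nonnegative half is `P`-periodic. -/
def perSet (A : Type*) (P : ℕ) : Set (ℤ → A) := {x | ∀ k : ℕ, x (k : ℤ) = x ((k : ℤ) + P)}

lemma measurableSet_perSet {A : Type*} [Fintype A] [MeasurableSpace A]
    [MeasurableSingletonClass A] (P : ℕ) : MeasurableSet (perSet A P) := by
  have : perSet A P = ⋂ k : ℕ, {x | x (k : ℤ) = x ((k : ℤ) + P)} := by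
    ext x
    simp [perSet]
  rw [this]
  refine MeasurableSet.iInter fun k => ?_
  exact measurableSet_eq_fun (measurable_pi_apply _) (measurable_pi_apply _)

lemma mem_agreeSet_of_perSet {A : Type*} {P : ℕ} {x : ℤ → A} (hx : x ∈ perSet A P) (m T : ℕ) :
    shift^[m] x ∈ agreeSet A m (P * T) := by
  intro k hk
  rw [shift_iterate, shift_iterate]
  rw [abs_le] at hk
  obtain ⟨j, hj⟩ := Int.eq_ofNat_of_zero_le (a := k + m) (by omega)
  have := period_mul x 0 P (j + P * T + 1) (fun k _ => by simpa using hx k) T j (by omega)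
  rw [hj, show k + ((P * T : ℕ) : ℤ) + m = (j : ℤ) + (P * T : ℕ) by omega]
  simpa using this

lemma core {A : Type*} [Fintype A] [MeasurableSpace A] [MeasurableSingletonClass A]
    (X : Set (ℤ → A)) (hne : X.Nonempty) (hinv : shift ⁻¹' X = X) (C : ℕ) (hC1 : 1 ≤ C)
    (hC : ∃ᶠ q : ℕ in atTop, scomplexity X q ≤ C * q) :
    ∃ δ : ℝ≥0∞, 0 < δ ∧
      ∀ μ : Measure (ℤ → A), IsProbabilityMeasure μ → (∀ᵐ x ∂μ, x ∈ X) → Ergodic shift μ →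
        ∀ m T : ℕ, ∃ t, T ≤ t ∧ δ ≤ μ (agreeSet A m t) := by
  set D := 2 * C with hD
  set K := 3 * C + 1 with hK
  set M := D * Fintype.card A ^ D with hM
  have hA : 1 ≤ Fintype.card A := Fintype.card_pos_iff.2 ⟨hne.some 0⟩
  have hM1 : 1 ≤ M := Nat.mul_pos (by omega) (Nat.pow_pos hA)
  set Q := 4 * (M * ((D + 2) * K)) with hQ
  have hQ1 : 1 ≤ Q := by
    have : 0 < M * ((D + 2) * K) := Nat.mul_pos hM1 (Nat.mul_pos (by omega) (by omega))
    omega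
  refine ⟨(Q : ℝ≥0∞)⁻¹, by simp, fun μ hprob hμX hμ m T0 => ?_⟩
  obtain ⟨T, hT0, hT1⟩ : ∃ T, T0 ≤ T ∧ 1 ≤ T := ⟨T0 + 1, by omega, by omega⟩
  by_cases hper : ∃ P, 1 ≤ P ∧ perSet A P =ᵐ[μ] Set.univ
  · obtain ⟨P, hP, hPu⟩ := hper
    refine ⟨P * T, hT0.trans (Nat.le_mul_of_pos_left _ hP), ?_⟩
    rw [← (hμ.toMeasurePreserving.iterate m).measure_preimage
      (measurableSet_agreeSet _ _).nullMeasurableSet]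
    calc (Q : ℝ≥0∞)⁻¹ ≤ 1 := by
          rw [ENNReal.inv_le_one]
          exact_mod_cast hQ1
      _ = μ (perSet A P) := by rw [measure_congr hPu, measure_univ]
      _ ≤ _ := measure_mono fun x hx => mem_agreeSet_of_perSet hx m T
  have hper0 : ∀ P, 1 ≤ P → μ (perSet A P) = 0 := by
    intro P hP
    have hle : perSet A P ⊆ shift ⁻¹' perSet A P := by
      intro x hx k
      have := hx (k + 1)
      simp only [shift]
      push_cast at this
      rw [this]
      congr 1
      ring
    rcases hμ.ae_empty_or_univ_of_ae_le_preimage (s := perSet A P)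
      (measurableSet_perSet P).nullMeasurableSet
      (Eventually.of_forall fun x hx => hle hx) with h | h
    · rw [measure_congr h, measure_empty]
    · exact absurd ⟨P, hP, h⟩ hper
  obtain ⟨r, hrN, hrL, hrS⟩ := exists_good_length X hne C hC (4 * m + 2 * (T * T) + 4)
  obtain ⟨Ts, hTs, hTs1, hcomb⟩ := comb hne hinv r (K * r) D (by omega)
    (by rw [hK, add_mul]; omega) hrS
  have hnp : ∀ᵐ x ∂μ, ¬ ∃ a P : ℕ, 1 ≤ P ∧ ∀ k : ℕ, x ((a : ℤ) + k) = x ((a : ℤ) + k + P) := by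
    push Not
    rw [ae_all_iff]
    intro a
    rw [ae_all_iff]
    intro P
    by_cases hP : 1 ≤ P
    · have h0 : μ (shift^[a] ⁻¹' perSet A P) = 0 := by
        rw [(hμ.toMeasurePreserving.iterate a).measure_preimage
          (measurableSet_perSet _).nullMeasurableSet, hper0 P hP]
      have := measure_eq_zero_iff_ae_notMem.1 h0
      filter_upwards [this] with x hx _
      by_contra! hcon
      apply hx
      intro k
      rw [shift_iterate, shift_iterate]
      have := hcon k
      rw [add_comm, this]
      congr 1
      ring
    · exact Eventually.of_forall fun x h => absurd h hP
  let f : ℕ → ℕ := fun t => if T ≤ t then t else t * T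
  have hfT : ∀ t, 1 ≤ t → T ≤ f t := by
    intro t ht
    simp only [f]
    split_ifs with h
    · exact h
    · exact Nat.le_mul_of_pos_left _ ht
  suffices ∃ t ∈ Ts, (Q : ℝ≥0∞)⁻¹ ≤ μ (agreeSet A m (f t)) by
    obtain ⟨t, ht, h⟩ := this
    exact ⟨f t, hT0.trans (hfT t (hTs1 t ht)), h⟩
  by_contra! hcon
  set V := (D + 2) * (K * r) with hV
  have hpt : ∀ᵐ x ∂μ, ((r / 2 : ℕ) : ℝ≥0∞) ≤ ∑ t ∈ Ts, ∑ n ∈ Finset.range V,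
      (shift^[n] ⁻¹' agreeSet A m (f t)).indicator 1 x := by
    filter_upwards [hμX, hnp] with x hxX hxp
    obtain ⟨s, hs, t, ht, hst⟩ := (hcomb x hxX).resolve_left hxp
    refine le_trans ?_ (Finset.single_le_sum (f := fun t => ∑ n ∈ Finset.range V,
      (shift^[n] ⁻¹' agreeSet A m (f t)).indicator (1 : (ℤ → A) → ℝ≥0∞) x)
      (fun _ _ => bot_le) ht)
    have hrV : s + r ≤ V := by
      rw [hV, show D + 2 = (D + 1) + 1 by rfl, add_mul, one_mul]
      exact add_le_add hs (Nat.le_mul_of_pos_left _ (by omega))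
    have hsub : Finset.Ico (s + m) (s + m + r / 2) ⊆ Finset.range V := by
      intro n hn
      rw [Finset.mem_Ico] at hn
      rw [Finset.mem_range]
      omega
    refine le_trans (le_of_eq ?_) (Finset.sum_le_sum_of_subset hsub)
    rw [Finset.sum_congr rfl (g := fun _ => (1 : ℝ≥0∞))]
    · simp
    · intro n hn
      rw [Finset.mem_Ico] at hn
      rw [Set.indicator_of_mem]
      · rfl
      intro k hk
      rw [shift_iterate, shift_iterate]
      rw [abs_le] at hk
      obtain ⟨j, hj⟩ := Int.eq_ofNat_of_zero_le (a := k + n - s) (by omega)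
      rw [show k + (n : ℤ) = (s : ℤ) + j by omega,
        show k + ((f t : ℕ) : ℤ) + n = (s : ℤ) + j + (f t : ℕ) by omega]
      simp only [f]
      split_ifs with h
      · exact hst j (by omega)
      · apply period_mul x s t r hst T j
        have : t * T ≤ T * T := Nat.mul_le_mul_right _ (by omega)
        omega
  have hintg := lintegral_mono_ae hpt
  rw [lintegral_const, measure_univ, mul_one, lintegral_finsetSum] at hintg
  swap
  · intro t _
    refine Finset.measurable_sum _ fun n _ => ?_
    exact measurable_one.indicator
      ((hμ.toMeasurePreserving.iterate n).measurable (measurableSet_agreeSet _ _))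
  have hterm : ∀ t ∈ Ts, ∫⁻ x, ∑ n ∈ Finset.range V,
      (shift^[n] ⁻¹' agreeSet A m (f t)).indicator 1 x ∂μ ≤ (V : ℝ≥0∞) * (Q : ℝ≥0∞)⁻¹ := by
    intro t ht
    rw [lintegral_finsetSum]
    · calc _ ≤ ∑ n ∈ Finset.range V, (Q : ℝ≥0∞)⁻¹ := by
            refine Finset.sum_le_sum fun n _ => ?_
            rw [lintegral_indicator_one
              ((hμ.toMeasurePreserving.iterate n).measurable (measurableSet_agreeSet _ _)),
              (hμ.toMeasurePreserving.iterate n).measure_preimage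
                (measurableSet_agreeSet _ _).nullMeasurableSet]
            exact (hcon t ht).le
        _ = _ := by simp
    · intro n _
      exact measurable_one.indicator
        ((hμ.toMeasurePreserving.iterate n).measurable (measurableSet_agreeSet _ _))
  have hfinal : ((r / 2 : ℕ) : ℝ≥0∞) ≤ (M : ℝ≥0∞) * ((V : ℝ≥0∞) * (Q : ℝ≥0∞)⁻¹) := by
    refine hintg.trans ((Finset.sum_le_sum hterm).trans ?_)
    rw [Finset.sum_const, nsmul_eq_mul]
    gcongr
  have h4 : ((4 * (r / 2) : ℕ) : ℝ≥0∞) ≤ (r : ℕ) := by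
    calc ((4 * (r / 2) : ℕ) : ℝ≥0∞) = 4 * ((r / 2 : ℕ) : ℝ≥0∞) := by push_cast; rfl
      _ ≤ 4 * ((M : ℝ≥0∞) * ((V : ℝ≥0∞) * (Q : ℝ≥0∞)⁻¹)) := by gcongr
      _ = (r : ℝ≥0∞) * ((Q : ℝ≥0∞) * (Q : ℝ≥0∞)⁻¹) := by
        rw [hQ, hV]
        push_cast
        ring
      _ = r := by
        rw [ENNReal.mul_inv_cancel (by simp; omega) (by simp), mul_one]
  have h5 : 4 * (r / 2) ≤ r := by exact_mod_cast h4
  omega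

/-- If `X` is a subshift over a finite alphabet with `liminf p(q)/q < ∞`, then there
is a constant `δ > 0`, depending only on `X`, such that every ergodic shift-invariant
Borel probability measure on `X` is `δ`-partially rigid: there is a sequence
`t n → ∞` with `liminf_n μ(σ^{-t n} A ∩ A) ≥ δ μ(A)` for all Borel sets `A`. -/
theorem nonsuperlinear_implies_partially_rigid {A : Type*} [Fintype A]
    [TopologicalSpace A] [DiscreteTopology A]
    [MeasurableSpace A] [MeasurableSingletonClass A]
    (X : Set (ℤ → A)) (hne : X.Nonempty) (hclosed : IsClosed X)
    (hinv : shift ⁻¹' X = X)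
    (hp : Filter.liminf (fun q => (scomplexity X q : ℝ≥0∞) / (q : ℝ≥0∞)) atTop < ⊤) :
    ∃ δ : ℝ≥0∞, 0 < δ ∧
      ∀ μ : Measure (ℤ → A), IsProbabilityMeasure μ → μ X = 1 → Ergodic shift μ →
        ∃ t : ℕ → ℕ, Tendsto t atTop atTop ∧
          ∀ B : Set (ℤ → A), MeasurableSet B →
            δ * μ B ≤ Filter.liminf (fun n => μ (shift^[t n] ⁻¹' B ∩ B)) atTop := by
  obtain ⟨C, hC1, hC⟩ := exists_linear_bound X hp
  obtain ⟨δ, hδ, h⟩ := core X hne hinv C hC1 hC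
  refine ⟨δ, hδ, fun μ hprob hX hμ => ?_⟩
  have hbA : BorelSpace A := ⟨by
    ext s
    constructor
    · intro _
      exact MeasurableSpace.measurableSet_generateFrom (isOpen_discrete s)
    · intro _
      exact (Set.toFinite s).measurableSet⟩
  have hXm : MeasurableSet X := hclosed.measurableSet
  have hae : ∀ᵐ x ∂μ, x ∈ X := (mem_ae_iff_prob_eq_one hXm).2 hX
  exact rigid_of_agree μ hμ δ hδ (h μ hprob hae hμ)
end

section
/- Let w be a finite word and let u and v both be roots of w with u·u a suffix of w and |v| < |u|. Then there exists a suffix v₀ of v and positive integers n, m such that u = v₀^n and v = v₀^m. In particular, if v is the minimal root of w and u is a root of w such that u·u is a suffix of w, then u = v^n for some positive integer n. -/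
/-- `n`-fold concatenation (power) of a word. -/
def wpow {α : Type*} (v : List α) (n : ℕ) : List α := (List.replicate n v).flatten

/-- `v` is a root of `w`: `w = v' · v^j` with `j ≥ 1` and `v'` a (possibly empty)
suffix of `v`. -/
def IsRoot {α : Type*} (v w : List α) : Prop :=
  v.length ≤ w.length ∧ ∃ j, 1 ≤ j ∧ ∃ v' : List α, v' <:+ v ∧ w = v' ++ wpow v j

/-- `v` is the minimal (shortest) root of `w`. -/
def IsMinimalRoot {α : Type*} (v w : List α) : Prop :=
  IsRoot v w ∧ ∀ u : List α, IsRoot u w → v.length ≤ u.length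

theorem wpow_zero' {α : Type*} (v : List α) : wpow v 0 = [] := by simp [wpow]

theorem wpow_add' {α : Type*} (v : List α) (m n : ℕ) :
    wpow v (m + n) = wpow v m ++ wpow v n := by
  unfold wpow
  rw [← List.flatten_append, List.replicate_append_replicate]

theorem wpow_one' {α : Type*} (v : List α) : wpow v 1 = v := by simp [wpow]

theorem wpow_wpow' {α : Type*} (v : List α) (m n : ℕ) :
    wpow (wpow v m) n = wpow v (m * n) := by
  induction n with
  | zero => simp [wpow_zero']
  | succ k ih => rw [wpow_add', ih, wpow_one', Nat.mul_succ, wpow_add']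

theorem suffix_wpow {α : Type*} (v : List α) (m : ℕ) (hm : 1 ≤ m) : v <:+ wpow v m := by
  obtain ⟨k, rfl⟩ : ∃ k, m = k + 1 := ⟨m - 1, by omega⟩
  exact ⟨wpow v k, by rw [wpow_add', wpow_one']⟩

theorem comm_common {α : Type*} (N : ℕ) : ∀ u v : List α, u.length + v.length ≤ N →
    u ++ v = v ++ u → ∃ z : List α, ∃ n m : ℕ, u = wpow z n ∧ v = wpow z m := by
  induction N with
  | zero =>
    intro u v h _
    have hu : u = [] := List.length_eq_zero_iff.1 (by omega)
    have hv : v = [] := List.length_eq_zero_iff.1 (by omega)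
    exact ⟨[], 0, 0, by simp [hu, wpow_zero'], by simp [hv, wpow_zero']⟩
  | succ N ih =>
    intro u v h huv
    by_cases hu : u = []
    · exact ⟨v, 0, 1, by simp [hu, wpow_zero'], by simp [wpow_one']⟩
    by_cases hv : v = []
    · exact ⟨u, 1, 0, by simp [wpow_one'], by simp [hv, wpow_zero']⟩
    have hu' := List.length_pos_iff.2 hu
    have hv' := List.length_pos_iff.2 hv
    rcases le_total v.length u.length with hl | hl
    · obtain ⟨t, rfl⟩ : v <+: u :=
        List.prefix_of_prefix_length_le (l₃ := u ++ v) ⟨u, huv.symm⟩ ⟨v, rfl⟩ hl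
      have h2 : t ++ v = v ++ t := by
        rw [List.append_assoc] at huv
        exact List.append_cancel_left huv
      rw [List.length_append] at h
      obtain ⟨z, n, m, h3, h4⟩ := ih t v (by omega) h2
      exact ⟨z, m + n, m, by rw [wpow_add', ← h3, ← h4], h4⟩
    · obtain ⟨t, rfl⟩ : u <+: v :=
        List.prefix_of_prefix_length_le (l₃ := u ++ v) ⟨v, rfl⟩ ⟨u, huv.symm⟩ hl
      have h2 : u ++ t = t ++ u := by
        rw [List.append_assoc] at huv
        exact List.append_cancel_left huv
      rw [List.length_append] at h
      obtain ⟨z, n, m, h3, h4⟩ := ih u t (by omega) h2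
      exact ⟨z, n, n + m, h3, by rw [wpow_add', ← h3, ← h4]⟩

theorem IsRoot.suffix {α : Type*} {v w : List α} (h : IsRoot v w) : v <:+ w := by
  obtain ⟨_, j, hj, v', _, rfl⟩ := h
  exact (suffix_wpow v j hj).trans (List.suffix_append _ _)

theorem suffix_decomp {α : Type*} (z : List α) : ∀ (m : ℕ) (x : List α), x <:+ wpow z m →
    ∃ k, ∃ z' : List α, z' <:+ z ∧ x = z' ++ wpow z k := by
  intro m
  induction m with
  | zero =>
    intro x hx
    rw [wpow_zero', List.suffix_nil] at hx
    exact ⟨0, [], List.nil_suffix, by simp [hx, wpow_zero']⟩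
  | succ m ih =>
    intro x hx
    rcases le_total x.length z.length with hl | hl
    · exact ⟨0, x, List.suffix_of_suffix_length_le hx (suffix_wpow z _ (by omega)) hl,
        by simp [wpow_zero']⟩
    · obtain ⟨y, rfl⟩ := List.suffix_of_suffix_length_le (suffix_wpow z _ (by omega)) hx hl
      rw [wpow_add', wpow_one'] at hx
      have hy : y <:+ wpow z m := by
        obtain ⟨s, hs⟩ := hx
        rw [← List.append_assoc] at hs
        exact ⟨s, List.append_cancel_right hs⟩
      obtain ⟨k, z', h1, rfl⟩ := ih y hy
      exact ⟨k + 1, z', h1, by rw [wpow_add', wpow_one', List.append_assoc]⟩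

theorem roots_common_aux {α : Type*} (w u v : List α) (hu : IsRoot u w) (hv : IsRoot v w)
    (huu : (u ++ u) <:+ w) (hl : v.length < u.length) :
    ∃ v₀ : List α, v₀ <:+ v ∧ ∃ n m : ℕ, 1 ≤ n ∧ 1 ≤ m ∧ u = wpow v₀ n ∧ v = wpow v₀ m := by
  have hvu : v <:+ u := List.suffix_of_suffix_length_le hv.suffix hu.suffix hl.le
  have hvne : v ≠ [] := by
    rintro rfl
    obtain ⟨_, j, hj, v', h1, h2⟩ := hv
    rw [List.suffix_nil] at h1
    have hw : w = [] := by simp [h2, h1, wpow]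
    have := hu.1
    simp [hw] at this
    simp [this] at hl
  have hwv : w <:+ w ++ v := by
    obtain ⟨_, j, hj, v', ⟨s, hs⟩, h2⟩ := hv
    refine ⟨v' ++ s, ?_⟩
    rw [h2, List.append_assoc, List.append_assoc, ← List.append_assoc s, hs]
    congr 1
    conv_lhs => rw [← wpow_one' v, wpow_wpow', one_mul, ← wpow_add', add_comm, wpow_add', wpow_one']
  have h1 : u ++ v <:+ w ++ v := by
    obtain ⟨s, hs⟩ := hu.suffix
    exact ⟨s, by rw [← List.append_assoc, hs]⟩
  have h2 : v ++ u <:+ w ++ v := by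
    refine List.IsSuffix.trans ?_ (huu.trans hwv)
    obtain ⟨s, hs⟩ := hvu
    exact ⟨s, by rw [← List.append_assoc, hs]⟩
  have hc : u ++ v = v ++ u :=
    (List.suffix_of_suffix_length_le h1 h2 (by simp; omega)).eq_of_length (by simp; omega)
  obtain ⟨z, n, m, h3, h4⟩ := comm_common _ u v le_rfl hc
  have hm : 1 ≤ m := by
    rcases Nat.eq_zero_or_pos m with rfl | h
    · exact absurd (h4.trans (wpow_zero' z)) hvne
    · exact h
  have hn : 1 ≤ n := by
    rcases Nat.eq_zero_or_pos n with rfl | h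
    · rw [h3, wpow_zero'] at hl
      simp at hl
    · exact h
  exact ⟨z, h4 ▸ suffix_wpow z m hm, n, m, hn, hm, h3, h4⟩

/-- If `u` and `v` are roots of `w`, `u·u` is a suffix of `w` and `|v| < |u|`, then
`u` and `v` are powers of a common suffix `v₀` of `v`.  In particular, if `v` is the
minimal root of `w` and `u` is a root of `w` with `u·u` a suffix of `w`, then `u` is
a power of `v`. -/
theorem roots_common_power {α : Type*} :
    (∀ w u v : List α, IsRoot u w → IsRoot v w → (u ++ u) <:+ w → v.length < u.length →
      ∃ v₀ : List α, v₀ <:+ v ∧ ∃ n m : ℕ, 1 ≤ n ∧ 1 ≤ m ∧ u = wpow v₀ n ∧ v = wpow v₀ m) ∧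
    (∀ w u v : List α, IsMinimalRoot v w → IsRoot u w → (u ++ u) <:+ w →
      ∃ n : ℕ, 1 ≤ n ∧ u = wpow v n) := by
  refine ⟨roots_common_aux, ?_⟩
  intro w u v hv hu huu
  rcases (hv.2 u hu).lt_or_eq with hl | hl
  · obtain ⟨z, hz, n, m, hn, hm, h1, h2⟩ := roots_common_aux w u v hu hv.1 huu hl
    have hzl : z.length ≤ w.length := hz.length_le.trans hv.1.1
    have hw : w <:+ wpow z (m * (1 + hv.1.2.choose)) := by
      obtain ⟨hj, v', ⟨s, hs⟩, h⟩ := hv.1.2.choose_spec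
      rw [← wpow_wpow', ← h2, wpow_add', wpow_one']
      exact ⟨s, by conv_lhs => rw [h, ← List.append_assoc, hs]⟩
    have hroot : IsRoot z w := by
      refine ⟨hzl, ?_⟩
      obtain ⟨k, z', h3, h4⟩ := suffix_decomp z _ w hw
      rcases Nat.eq_zero_or_pos k with rfl | hk
      · rw [wpow_zero', List.append_nil] at h4
        subst h4
        exact ⟨1, le_rfl, [], List.nil_suffix, by
          rw [wpow_one', List.nil_append]; exact h3.eq_of_length_le hzl⟩
      · exact ⟨k, hk, z', h3, h4⟩
    have : z = v := hz.eq_of_length_le (hv.2 z hroot)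
    exact ⟨n, hn, this ▸ h1⟩
  · refine ⟨1, le_rfl, ?_⟩
    rw [wpow_one']
    exact ((List.suffix_of_suffix_length_le hv.1.suffix hu.suffix hl.le).eq_of_length hl).symm
end
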